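/- For b = (b_1,...,b_n) ∈ ℤ_{>0}^n with b_1 ≥ 2, the number of k-dimensional faces of the b-parking-function polytope X_n(b) is ∑_{j=0}^{n-k} C(n,j)·(n-k-j)!·S(n-j+1, n-k-j+1), where C(n,j) is a binomial coefficient and S(·,·) is a Stirling number of the second kind. -/

import Mathlib

open Nat

/-- Partial sum `S_i = b_1 + ⋯ + b_i`, where `b j` denotes `b_{j+1}` (0-indexed). -/
def Spart (b : ℕ → ℕ) (i : ℕ) : ℕ := ∑ j ∈ Finset.range i, b j

/-- A `b`-parking function. -/
def IsBParkingFunction (n : ℕ) (b : ℕ → ℕ) (β : Fin n → ℕ) : Prop :=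
  (∀ i, 1 ≤ β i) ∧ ∃ σ : Equiv.Perm (Fin n),
    Monotone (β ∘ σ) ∧ ∀ i : Fin n, β (σ i) ≤ Spart b ((i : ℕ) + 1)

/-- The `b`-parking-function polytope: the convex hull of all `b`-parking
functions of length `n` in `ℝⁿ`. -/
noncomputable def bpfPolytope (n : ℕ) (b : ℕ → ℕ) : Set (Fin n → ℝ) :=
  convexHull ℝ {x | ∃ β : Fin n → ℕ, IsBParkingFunction n b β ∧ x = fun i => (β i : ℝ)}

/-- The number of `k`-dimensional faces of the `b`-parking-function polytope:
nonempty exposed faces whose affine hull has dimension `k`. -/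
noncomputable def faceCount (n : ℕ) (b : ℕ → ℕ) (k : ℕ) : ℕ :=
  {F : Set (Fin n → ℝ) | F.Nonempty ∧ IsExposed ℝ (bpfPolytope n b) F ∧
    Module.finrank ℝ (vectorSpan ℝ F) = k}.ncard

/-- Stirling numbers of the second kind. -/
def stirling2 : ℕ → ℕ → ℕ
  | 0, 0 => 1
  | 0, _ + 1 => 0
  | _ + 1, 0 => 0
  | n + 1, k + 1 => (k + 1) * stirling2 n (k + 1) + stirling2 n k

/-- The functions `Fin p → β` taking the value `z` exactly `j` times whose remaining values,
together with `o`, form the set `S`. -/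
def patternFinset {β : Type*} [Fintype β] [DecidableEq β] (z o : β) (p j : ℕ) (S : Finset β) :
    Finset (Fin p → β) :=
  {f | (Finset.univ.filter fun i => f i = z).card = j ∧
    insert o ((Finset.univ.image f).erase z) = S}

lemma card_filter_fin_cons {β : Type*} [Fintype β] [DecidableEq β] (p : ℕ)
    (P : (Fin (p + 1) → β) → Prop) [DecidablePred P] :
    (Finset.univ.filter P).card
      = ∑ v : β, (Finset.univ.filter fun f : Fin p → β => P (Fin.cons v f)).card := by
  simp only [Finset.card_filter]
  rw [← (Fin.consEquiv fun _ => β).sum_comp, Fintype.sum_prod_type]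
  rfl

lemma card_filter_cons_eq {β : Type*} [DecidableEq β] {p : ℕ} (z v : β) (f : Fin p → β) :
    (Finset.univ.filter fun i => (Fin.cons v f : Fin (p + 1) → β) i = z).card
      = (if v = z then 1 else 0) + (Finset.univ.filter fun i => f i = z).card := by
  simp only [Finset.card_filter, Fin.sum_univ_succ, Fin.cons_zero, Fin.cons_succ]

lemma image_cons {β : Type*} [DecidableEq β] {p : ℕ} (v : β) (f : Fin p → β) :
    Finset.univ.image (Fin.cons v f : Fin (p + 1) → β) = insert v (Finset.univ.image f) := by
  ext w
  simp [Fin.exists_fin_succ, eq_comm]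

lemma card_patternFinset_succ {β : Type*} [Fintype β] [DecidableEq β] {z o : β}
    (p : ℕ) {S : Finset β} (hz : z ∉ S) (ho : o ∈ S) (j : ℕ) :
    (patternFinset z o (p + 1) j S).card
      = (if j = 0 then 0 else (patternFinset z o p (j - 1) S).card)
        + S.card * (patternFinset z o p j S).card
        + ∑ v ∈ S.erase o, (patternFinset z o p j (S.erase v)).card := by
  have hoz : o ≠ z := by rintro rfl; exact hz ho
  unfold patternFinset
  rw [card_filter_fin_cons]
  simp only [card_filter_cons_eq, image_cons]
  have key : ∀ v : β, (Finset.univ.filter fun f : Fin p → β =>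
        (if v = z then 1 else 0) + (Finset.univ.filter fun i => f i = z).card = j ∧
          insert o ((insert v (Finset.univ.image f)).erase z) = S).card
      = (if v = z then (if j = 0 then 0 else (patternFinset z o p (j - 1) S).card) else 0)
        + (if v ∈ S then (patternFinset z o p j S).card else 0)
        + (if v ∈ S.erase o then (patternFinset z o p j (S.erase v)).card else 0) := by
    intro v
    by_cases hvz : v = z
    · subst hvz
      simp only [if_true, hz, if_false, Finset.mem_erase, and_false, add_zero]
      split_ifs with hj
      · subst hj
        simp
      · congr 1
        ext f
        simp only [patternFinset, Finset.mem_filter, Finset.mem_univ, true_and]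
        refine and_congr (by omega) ?_
        rw [Finset.erase_insert_eq_erase]
    · simp only [hvz, if_false, zero_add]
      by_cases hvS : v ∈ S
      swap
      · rw [if_neg hvS, if_neg (by simp [hvS]), Finset.card_eq_zero,
          Finset.filter_eq_empty_iff]
        rintro f - ⟨-, h⟩
        apply hvS
        rw [← h]
        simp [hvz]
      have hI : ∀ f : Fin p → β, insert o ((insert v (Finset.univ.image f)).erase z)
          = insert v (insert o ((Finset.univ.image f).erase z)) := by
        intro f
        rw [Finset.erase_insert_of_ne hvz, Finset.insert_comm]
      simp only [hI, if_pos hvS]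
      by_cases hvo : v = o
      · subst hvo
        simp [patternFinset]
      · rw [if_pos (by simp [hvo, hvS]), ← Finset.card_union_of_disjoint]
        · congr 1
          ext f
          simp only [patternFinset, Finset.mem_union, Finset.mem_filter, Finset.mem_univ, true_and,
            ← and_or_left]
          refine and_congr_right fun _ => ⟨fun h => ?_, ?_⟩
          · by_cases hv : v ∈ insert o ((Finset.univ.image f).erase z)
            · left; rwa [Finset.insert_eq_of_mem hv] at h
            · right; rw [← h, Finset.erase_insert hv]
          · rintro (h | h)
            · rw [h, Finset.insert_eq_of_mem hvS]
            · rw [h, Finset.insert_erase hvS]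
        · rw [Finset.disjoint_left]
          intro f hf hf'
          simp only [patternFinset, Finset.mem_filter, Finset.mem_univ, true_and] at hf hf'
          have := hf.2.symm.trans hf'.2
          rw [this] at hvS
          simp at hvS
  rw [Finset.sum_congr rfl fun v _ => key v]
  simp only [Finset.sum_add_distrib, Finset.sum_ite_eq', Finset.mem_univ, if_true,
    Finset.sum_ite_mem, Finset.univ_inter, Finset.sum_const, smul_eq_mul]
  rfl

lemma card_patternFinset {β : Type*} [Fintype β] [DecidableEq β] {z o : β} (p : ℕ) :
    ∀ (j m : ℕ) (S : Finset β), z ∉ S → o ∈ S → S.card = m + 1 →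
      (patternFinset z o p j S).card = p.choose j * m ! * stirling2 (p - j + 1) (m + 1) := by
  induction p with
  | zero =>
    intro j m S hz ho hS
    rcases j with - | j
    · rcases m with - | m
      · have : S = {o} := by
          obtain ⟨a, rfl⟩ := Finset.card_eq_one.1 hS
          simp at ho; simp [ho]
        subst this
        simp [patternFinset, stirling2]
      · have : ({o} : Finset β) ≠ S := by
          rintro rfl; simp at hS
        simp [patternFinset, stirling2, this]
    · simp [patternFinset]
  | succ p ih =>
    intro j m S hz ho hS
    rw [card_patternFinset_succ p hz ho, hS, ih j m S hz ho hS]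
    have herase : ∑ v ∈ S.erase o, (patternFinset z o p j (S.erase v)).card
        = m ! * (p.choose j * stirling2 (p - j + 1) m) := by
      rcases m with - | m
      · have : S.erase o = ∅ := by
          rw [← Finset.card_eq_zero, Finset.card_erase_of_mem ho, hS]
        simp [this, stirling2]
      · rw [Finset.sum_congr rfl fun v hv => ih j m (S.erase v) ?_ ?_ ?_, Finset.sum_const,
          Finset.card_erase_of_mem ho, hS, Nat.factorial_succ]
        · simp only [smul_eq_mul, Nat.add_sub_cancel]; ring
        · simp [hz]
        · simp only [Finset.mem_erase] at hv ⊢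
          exact ⟨hv.1.symm, ho⟩
        · rw [Finset.card_erase_of_mem (Finset.mem_of_mem_erase hv), hS]; rfl
    rw [herase]
    rcases j with - | j
    · simp only [if_true, Nat.choose_zero_right, Nat.sub_zero]
      rw [show stirling2 (p + 1 + 1) (m + 1)
        = (m + 1) * stirling2 (p + 1) (m + 1) + stirling2 (p + 1) m from rfl]
      ring
    · rw [if_neg (by omega), Nat.add_sub_cancel, ih j m S hz ho hS, Nat.choose_succ_succ,
        Nat.add_sub_add_right]
      rcases Nat.lt_or_ge p (j + 1) with h | h
      · simp [Nat.choose_eq_zero_of_lt h]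
      · obtain ⟨q, rfl⟩ := Nat.exists_eq_add_of_le h
        rw [show j + 1 + q - j = q + 1 by omega, show j + 1 + q - (j + 1) = q by omega,
          show stirling2 (q + 1 + 1) (m + 1)
            = (m + 1) * stirling2 (q + 1) (m + 1) + stirling2 (q + 1) m from rfl]
        ring

lemma Spart_succ (b : ℕ → ℕ) (i : ℕ) : Spart b (i + 1) = Spart b i + b i :=
  Finset.sum_range_succ b i

lemma Spart_mono (b : ℕ → ℕ) : Monotone (Spart b) :=
  monotone_nat_of_le_succ fun i => by rw [Spart_succ]; omega

lemma Spart_lt {n : ℕ} {b : ℕ → ℕ} (hb : ∀ j < n, 1 ≤ b j) {i j : ℕ} (hij : i < j) (hj : j ≤ n) :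
    Spart b i < Spart b j := by
  have h := Spart_mono b (Nat.succ_le_of_lt hij)
  have := hb i (by omega)
  rw [Nat.succ_eq_add_one, Spart_succ] at h
  omega

lemma two_le_Spart {b : ℕ → ℕ} (hb1 : 2 ≤ b 0) {i : ℕ} (hi : 0 < i) : 2 ≤ Spart b i := by
  have h := Spart_mono b (Nat.succ_le_of_lt hi)
  rw [Nat.succ_eq_add_one, Spart_succ] at h
  omega

/-- Any rearrangement below the bounds witnesses the parking property. -/
lemma isBParkingFunction_of_le {n : ℕ} {b : ℕ → ℕ} {β : Fin n → ℕ} (h1 : ∀ i, 1 ≤ β i)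
    (σ : Equiv.Perm (Fin n)) (hσ : ∀ i, β (σ i) ≤ Spart b ((i : ℕ) + 1)) :
    IsBParkingFunction n b β := by
  refine ⟨h1, Tuple.sort β, Tuple.monotone_sort β, fun i => ?_⟩
  by_contra! hlt
  have hmaps : ∀ k ∈ Finset.Ici i, σ.symm (Tuple.sort β k) ∈ Finset.Ioi i := by
    intro k hk
    rw [Finset.mem_Ici] at hk
    rw [Finset.mem_Ioi]
    by_contra! hle
    have h2 := hσ (σ.symm (Tuple.sort β k))
    rw [Equiv.apply_symm_apply] at h2
    have h3 : β (Tuple.sort β i) ≤ β (Tuple.sort β k) := Tuple.monotone_sort β hk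
    have h4 := Spart_mono b (Nat.succ_le_succ (Fin.le_def.1 hle))
    simp only [Nat.succ_eq_add_one] at h4
    omega
  have hcard := Finset.card_le_card_of_injOn _ hmaps (fun x _ y _ hxy => by simpa using hxy)
  rw [Fin.card_Ici, Fin.card_Ioi] at hcard
  have := i.2
  omega

/-- The sum of the `k` largest bounds. -/
def topSum (n : ℕ) (b : ℕ → ℕ) (k : ℕ) : ℕ := ∑ l ∈ Finset.range k, Spart b (n - l)

lemma topSum_succ (n : ℕ) (b : ℕ → ℕ) (k : ℕ) :
    topSum n b (k + 1) = topSum n b k + Spart b (n - k) :=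
  Finset.sum_range_succ _ k

lemma sum_Spart_le_topSum {n : ℕ} (b : ℕ → ℕ) (T : Finset (Fin n)) :
    ∑ i ∈ T, Spart b ((i : ℕ) + 1) ≤ topSum n b T.card := by
  induction T using Finset.induction_on_min with
  | empty => simp
  | insert a s ha ih =>
    have has : a ∉ s := fun h => lt_irrefl _ (ha a h)
    rw [Finset.sum_insert has, Finset.card_insert_of_notMem has, topSum_succ, add_comm]
    refine Nat.add_le_add ih (Spart_mono b ?_)
    have hsub : s ⊆ Finset.Ioi a := fun x hx => Finset.mem_Ioi.2 (ha x hx)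
    have := Finset.card_le_card hsub
    rw [Fin.card_Ioi] at this
    have := a.2
    omega

lemma sum_Spart_eq_topSum {n : ℕ} (b : ℕ → ℕ) (T : Finset (Fin n))
    (hT : IsUpperSet (T : Set (Fin n))) :
    ∑ i ∈ T, Spart b ((i : ℕ) + 1) = topSum n b T.card := by
  induction T using Finset.induction_on_min with
  | empty => simp [topSum]
  | insert a s ha ih =>
    have has : a ∉ s := fun h => lt_irrefl _ (ha a h)
    have hs : s = Finset.Ioi a := by
      ext x
      rw [Finset.mem_Ioi]
      refine ⟨ha x, fun hx => ?_⟩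
      have : x ∈ (↑(insert a s) : Set (Fin n)) := hT hx.le (by simp)
      simpa [hx.ne'] using this
    have hup : IsUpperSet (s : Set (Fin n)) := by
      rw [hs, Finset.coe_Ioi]
      exact isUpperSet_Ioi a
    rw [Finset.sum_insert has, Finset.card_insert_of_notMem has, topSum_succ, add_comm, ih hup]
    congr 2
    rw [hs, Fin.card_Ioi]
    have := a.2
    omega

lemma one_le_of_mem_bpfPolytope {n : ℕ} {b : ℕ → ℕ} {x : Fin n → ℝ} (hx : x ∈ bpfPolytope n b)
    (i : Fin n) : 1 ≤ x i := by
  have hconv : Convex ℝ {x : Fin n → ℝ | 1 ≤ x i} :=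
    convex_halfSpace_ge ⟨fun _ _ => rfl, fun _ _ => rfl⟩ 1
  refine convexHull_min ?_ hconv hx
  rintro _ ⟨β, hβ, rfl⟩
  exact (Nat.one_le_cast (α := ℝ)).2 (hβ.1 i)

lemma sum_le_topSum_of_mem_bpfPolytope {n : ℕ} {b : ℕ → ℕ} {x : Fin n → ℝ}
    (hx : x ∈ bpfPolytope n b) (T : Finset (Fin n)) : ∑ i ∈ T, x i ≤ topSum n b T.card := by
  have hlin : IsLinearMap ℝ fun x : Fin n → ℝ => ∑ i ∈ T, x i :=
    ⟨fun x y => by simp [Finset.sum_add_distrib], fun c x => by simp [Finset.mul_sum]⟩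
  refine convexHull_min ?_ (convex_halfSpace_le hlin (topSum n b T.card : ℝ)) hx
  rintro _ ⟨β, ⟨-, σ, -, hσ⟩, rfl⟩
  simp only [Set.mem_ofPred_eq]
  norm_cast
  calc ∑ i ∈ T, β i = ∑ i ∈ T.map σ.symm.toEmbedding, β (σ i) := by simp
    _ ≤ ∑ i ∈ T.map σ.symm.toEmbedding, Spart b ((i : ℕ) + 1) := Finset.sum_le_sum fun i _ => hσ i
    _ ≤ topSum n b T.card := by
      simpa using sum_Spart_le_topSum b (T.map σ.symm.toEmbedding)

/-- The face of the polytope on which the functional with coefficients `a` is maximal. -/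
def maxFace (n : ℕ) (b : ℕ → ℕ) (a : Fin n → ℝ) : Set (Fin n → ℝ) :=
  {x ∈ bpfPolytope n b | ∀ y ∈ bpfPolytope n b, ∑ i, a i * y i ≤ ∑ i, a i * x i}

/-- The inequalities of the polytope that are tight on `maxFace n b a`. -/
def IsTight (n : ℕ) (b : ℕ → ℕ) (a x : Fin n → ℝ) : Prop :=
  (∀ i, a i < 0 → x i = 1) ∧
    ∀ i, 0 < a i → ∑ j with a i ≤ a j, x j = topSum n b (Finset.univ.filter (a i ≤ a ·)).card

lemma isTight_of_sorted {n : ℕ} {b : ℕ → ℕ} {a : Fin n → ℝ} {σ : Equiv.Perm (Fin n)}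
    (hσ : Monotone (a ∘ σ)) {β : Fin n → ℕ}
    (hpos : ∀ i, 0 < a (σ i) → β (σ i) = Spart b ((i : ℕ) + 1))
    (hneg : ∀ i, a i < 0 → β i = 1) : IsTight n b a fun i => (β i : ℝ) := by
  refine ⟨fun i hi => by simp [hneg i hi], fun i hi => ?_⟩
  dsimp only
  norm_cast
  have hcard : (Finset.univ.filter fun j => a i ≤ a (σ j)).card
      = (Finset.univ.filter (a i ≤ a ·)).card := by
    simp only [Finset.card_filter]
    exact Equiv.sum_comp σ fun j => if a i ≤ a j then 1 else 0
  have hsum : ∑ j with a i ≤ a (σ j), β (σ j) = ∑ j with a i ≤ a j, β j := by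
    simp only [Finset.sum_filter]
    exact Equiv.sum_comp σ fun j => if a i ≤ a j then β j else 0
  rw [← hcard, ← hsum, ← sum_Spart_eq_topSum]
  · refine Finset.sum_congr rfl fun j hj => hpos j ?_
    exact hi.trans_le (Finset.mem_filter.1 hj).2
  · intro j k hjk hj
    simp only [Finset.coe_filter, Finset.mem_univ, true_and, Set.mem_ofPred_eq] at hj ⊢
    exact hj.trans (hσ hjk)

/-- Abel summation over the upper level sets of `a`. -/
lemma sum_mul_nonneg_of_level_sums {ι : Type*} [Fintype ι] (d a : ι → ℝ)
    (ha : ∀ i, 0 < a i → 0 ≤ ∑ j with a i ≤ a j, d j) :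
    0 ≤ ∑ j with 0 < a j, a j * d j ∧
      (∑ j with 0 < a j, a j * d j = 0 → ∀ i, 0 < a i → ∑ j with a i ≤ a j, d j = 0) := by
  induction hN : (Finset.univ.filter (0 < a ·)).card using Nat.strong_induction_on
    generalizing a with
  | _ N ih =>
    rcases (Finset.univ.filter (0 < a ·)).eq_empty_or_nonempty with he | hne
    · rw [he]
      exact ⟨by simp, fun _ i hi => absurd hi
        (by simpa using Finset.filter_eq_empty_iff.1 he (Finset.mem_univ i))⟩
    obtain ⟨i₀, hi₀, hmin⟩ := Finset.exists_min_image _ a hne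
    simp only [Finset.mem_filter, Finset.mem_univ, true_and] at hi₀ hmin
    have hlt : (Finset.univ.filter fun j => 0 < a j - a i₀).card < N := by
      rw [← hN]
      refine Finset.card_lt_card ?_
      rw [Finset.ssubset_iff_of_subset]
      · exact ⟨i₀, by simpa using hi₀, by simp⟩
      · intro j hj
        simp only [Finset.mem_filter, Finset.mem_univ, true_and] at hj ⊢
        linarith
    obtain ⟨hnn, heq⟩ := ih _ hlt (fun j => a j - a i₀) (fun i hi => by
      simpa using ha i (by linarith)) rfl
    have hlevel : Finset.univ.filter (a i₀ ≤ a ·) = Finset.univ.filter (0 < a ·) := by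
      ext j
      simp only [Finset.mem_filter, Finset.mem_univ, true_and]
      exact ⟨fun h => hi₀.trans_le h, hmin j⟩
    have hsplit : ∑ j with 0 < a j, a j * d j
        = a i₀ * ∑ j with a i₀ ≤ a j, d j
          + ∑ j with 0 < a j - a i₀, (a j - a i₀) * d j := by
      have : ∑ j with 0 < a j - a i₀, (a j - a i₀) * d j
          = ∑ j with 0 < a j, (a j - a i₀) * d j := by
        refine Finset.sum_subset ?_ ?_
        · intro j hj
          simp only [Finset.mem_filter, Finset.mem_univ, true_and] at hj ⊢
          linarith
        · intro j hj hj'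
          simp only [Finset.mem_filter, Finset.mem_univ, true_and] at hj hj'
          have := hmin j hj
          rw [show a j - a i₀ = 0 by linarith, zero_mul]
      rw [this, hlevel, Finset.mul_sum, ← Finset.sum_add_distrib]
      exact Finset.sum_congr rfl fun j _ => by ring
    have h0 := ha i₀ hi₀
    have hmul := mul_nonneg hi₀.le h0
    rw [hsplit]
    refine ⟨by linarith, fun h i hi => ?_⟩
    rcases (hmin i hi).eq_or_lt with hieq | hilt
    · rw [← hieq]
      have : a i₀ * ∑ j with a i₀ ≤ a j, d j = 0 := by linarith
      exact (mul_eq_zero.1 this).resolve_left hi₀.ne'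
    · simpa using heq (by linarith) i (by linarith)

lemma mem_bpfPolytope {n : ℕ} {b : ℕ → ℕ} {β : Fin n → ℕ} (h : IsBParkingFunction n b β) :
    (fun i => (β i : ℝ)) ∈ bpfPolytope n b :=
  subset_convexHull ℝ _ ⟨β, h, rfl⟩

/-- The parking function that gives the largest bounds to the positive coefficients in the order
`σ`, and is `1` elsewhere. -/
noncomputable def greedy {n : ℕ} (b : ℕ → ℕ) (a : Fin n → ℝ) (σ : Equiv.Perm (Fin n))
    (i : Fin n) : ℕ :=
  if 0 < a i then Spart b ((σ.symm i : ℕ) + 1) else 1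

lemma one_le_greedy {n : ℕ} {b : ℕ → ℕ} (hb1 : 2 ≤ b 0) (a : Fin n → ℝ)
    (σ : Equiv.Perm (Fin n)) (i : Fin n) : 1 ≤ greedy b a σ i := by
  unfold greedy
  split_ifs
  · exact le_trans (by norm_num) (two_le_Spart hb1 (Nat.succ_pos _))
  · rfl

lemma greedy_le {n : ℕ} {b : ℕ → ℕ} (hb1 : 2 ≤ b 0) (a : Fin n → ℝ)
    (σ : Equiv.Perm (Fin n)) (i : Fin n) : greedy b a σ (σ i) ≤ Spart b ((i : ℕ) + 1) := by
  unfold greedy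
  split_ifs
  · simp
  · exact le_trans (by norm_num) (two_le_Spart hb1 (Nat.succ_pos _))

lemma mem_maxFace_iff {n : ℕ} {b : ℕ → ℕ} (hb1 : 2 ≤ b 0) (a x : Fin n → ℝ) :
    x ∈ maxFace n b a ↔ x ∈ bpfPolytope n b ∧ IsTight n b a x := by
  have hσ := Tuple.monotone_sort a
  set σ := Tuple.sort a
  set g : Fin n → ℝ := fun i => (greedy b a σ i : ℝ) with hg
  have hgX : g ∈ bpfPolytope n b :=
    mem_bpfPolytope (isBParkingFunction_of_le (one_le_greedy hb1 a σ) σ (greedy_le hb1 a σ))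
  have hgT : IsTight n b a g := isTight_of_sorted hσ (fun i hi => by simp [greedy, hi])
    (fun i hi => by simp [greedy, hi.le])
  have hdecomp : ∀ y : Fin n → ℝ, ∑ i, a i * g i - ∑ i, a i * y i
      = ∑ j with 0 < a j, a j * (g j - y j) + ∑ j with ¬ 0 < a j, a j * (g j - y j) := by
    intro y
    rw [Finset.sum_filter_add_sum_filter_not, ← Finset.sum_sub_distrib]
    exact Finset.sum_congr rfl fun j _ => by ring
  have hneg : ∀ y ∈ bpfPolytope n b, ∀ j ∈ Finset.univ.filter (fun j => ¬ 0 < a j),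
      0 ≤ a j * (g j - y j) := by
    intro y hy j hj
    simp only [Finset.mem_filter, Finset.mem_univ, true_and, not_lt] at hj
    rcases hj.eq_or_lt with h | h
    · simp [h]
    · refine mul_nonneg_of_nonpos_of_nonpos hj ?_
      rw [hgT.1 j h]
      linarith [one_le_of_mem_bpfPolytope hy j]
  have hlayer : ∀ y ∈ bpfPolytope n b, _ := fun y hy =>
    sum_mul_nonneg_of_level_sums (fun j => g j - y j) a (fun i hi => by
      rw [Finset.sum_sub_distrib, hgT.2 i hi]
      linarith [sum_le_topSum_of_mem_bpfPolytope hy (Finset.univ.filter (a i ≤ a ·))])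
  have hmax : ∀ y ∈ bpfPolytope n b, ∑ i, a i * y i ≤ ∑ i, a i * g i := by
    intro y hy
    linarith [hdecomp y, Finset.sum_nonneg (hneg y hy), (hlayer y hy).1]
  constructor
  · rintro ⟨hx, hxmax⟩
    have h1 := hdecomp x
    have h2 := Finset.sum_nonneg (hneg x hx)
    obtain ⟨h3, h4⟩ := hlayer x hx
    have h5 := hxmax g hgX
    refine ⟨hx, fun i hi => ?_, fun i hi => ?_⟩
    · have h6 := (Finset.sum_eq_zero_iff_of_nonneg (hneg x hx)).1 (by linarith) i (by simp [hi.le])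
      have := (mul_eq_zero.1 h6).resolve_left hi.ne
      linarith [hgT.1 i hi]
    · have := h4 (by linarith) i hi
      rw [Finset.sum_sub_distrib, hgT.2 i hi] at this
      linarith
  · rintro ⟨hx, hT⟩
    refine ⟨hx, fun y hy => (hmax y hy).trans_eq ?_⟩
    obtain ⟨h', -⟩ := sum_mul_nonneg_of_level_sums (fun j => x j - g j) a (fun i hi => by
      rw [Finset.sum_sub_distrib, hgT.2 i hi, hT.2 i hi, sub_self])
    have h2 : ∑ j with ¬ 0 < a j, a j * (g j - x j) = 0 := by
      refine Finset.sum_eq_zero fun j hj => ?_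
      simp only [Finset.mem_filter, Finset.mem_univ, true_and, not_lt] at hj
      rcases hj.eq_or_lt with h | h
      · simp [h]
      · rw [hgT.1 j h, hT.1 j h, sub_self, mul_zero]
    have h3 : ∑ j with 0 < a j, a j * (g j - x j) = -∑ j with 0 < a j, a j * (x j - g j) := by
      rw [← Finset.sum_neg_distrib]
      exact Finset.sum_congr rfl fun j _ => by ring
    linarith [hdecomp x, hmax x hx]

lemma mem_maxFace_of_sorted {n : ℕ} {b : ℕ → ℕ} (hb1 : 2 ≤ b 0) {a : Fin n → ℝ}
    {σ : Equiv.Perm (Fin n)} (hσ : Monotone (a ∘ σ)) {β : Fin n → ℕ} (h1 : ∀ i, 1 ≤ β i)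
    (hle : ∀ i, β (σ i) ≤ Spart b ((i : ℕ) + 1))
    (hpos : ∀ i, 0 < a (σ i) → β (σ i) = Spart b ((i : ℕ) + 1))
    (hneg : ∀ i, a i < 0 → β i = 1) : (fun i => (β i : ℝ)) ∈ maxFace n b a :=
  (mem_maxFace_iff hb1 a _).2 ⟨mem_bpfPolytope (isBParkingFunction_of_le h1 σ hle),
    isTight_of_sorted hσ hpos hneg⟩

lemma greedy_mem_maxFace {n : ℕ} {b : ℕ → ℕ} (hb1 : 2 ≤ b 0) {a : Fin n → ℝ}
    {σ : Equiv.Perm (Fin n)} (hσ : Monotone (a ∘ σ)) :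
    (fun i => (greedy b a σ i : ℝ)) ∈ maxFace n b a :=
  mem_maxFace_of_sorted hb1 hσ (one_le_greedy hb1 a σ) (greedy_le hb1 a σ)
    (fun i hi => by simp [greedy, hi]) (fun i hi => by simp [greedy, hi.le])

lemma maxFace_nonempty {n : ℕ} {b : ℕ → ℕ} (hb1 : 2 ≤ b 0) (a : Fin n → ℝ) :
    (maxFace n b a).Nonempty :=
  ⟨_, greedy_mem_maxFace hb1 (Tuple.monotone_sort a)⟩

/-- On the face of `a`, a positive coordinate is at least the smallest bound of its level. -/
lemma Spart_le_of_mem_maxFace {n : ℕ} {b : ℕ → ℕ} (hb1 : 2 ≤ b 0) {a x : Fin n → ℝ}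
    (hx : x ∈ maxFace n b a) {i : Fin n} (hi : 0 < a i) :
    (Spart b (n - (Finset.univ.filter (a i ≤ a ·)).card + 1) : ℝ) ≤ x i := by
  obtain ⟨hX, -, hT⟩ := (mem_maxFace_iff hb1 a x).1 hx
  have hmem : i ∈ Finset.univ.filter (a i ≤ a ·) := by simp
  have hsum := hT i hi
  have hle := sum_le_topSum_of_mem_bpfPolytope hX ((Finset.univ.filter (a i ≤ a ·)).erase i)
  have hcard : (Finset.univ.filter (a i ≤ a ·)).card ≤ n := by
    simpa using Finset.card_le_univ (Finset.univ.filter (a i ≤ a ·))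
  rw [← Finset.add_sum_erase _ _ hmem] at hsum
  obtain ⟨k, hk⟩ := Nat.exists_eq_add_one_of_ne_zero (Finset.card_ne_zero_of_mem hmem)
  rw [Finset.card_erase_of_mem hmem, hk, Nat.add_sub_cancel] at hle
  rw [hk] at hcard
  rw [hk, topSum_succ, Nat.cast_add] at hsum
  rw [hk, show n - (k + 1) + 1 = n - k by omega]
  linarith

lemma two_le_of_mem_maxFace {n : ℕ} {b : ℕ → ℕ} (hb1 : 2 ≤ b 0) {a x : Fin n → ℝ}
    (hx : x ∈ maxFace n b a) {i : Fin n} (hi : 0 < a i) : 2 ≤ x i := by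
  have h := Spart_le_of_mem_maxFace hb1 hx hi
  refine le_trans ?_ h
  exact_mod_cast two_le_Spart hb1 (Nat.succ_pos _)

lemma lt_of_mem_maxFace {n : ℕ} {b : ℕ → ℕ} (hb : ∀ j < n, 1 ≤ b j) (hb1 : 2 ≤ b 0)
    {a x : Fin n → ℝ} (hx : x ∈ maxFace n b a) {i j : Fin n} (hi : 0 < a i) (hij : a j < a i) :
    x j < x i := by
  have h := Spart_le_of_mem_maxFace hb1 hx hi
  obtain ⟨hX, -, hT⟩ := (mem_maxFace_iff hb1 a x).1 hx
  have hsum := hT i hi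
  set T := Finset.univ.filter (a i ≤ a ·)
  have hmem : j ∉ T := by simp [T, hij]
  have hle := sum_le_topSum_of_mem_bpfPolytope hX (insert j T)
  rw [Finset.sum_insert hmem, Finset.card_insert_of_notMem hmem, topSum_succ, Nat.cast_add] at hle
  have hcard : T.card < n := by
    simpa using Finset.card_lt_univ_of_notMem hmem
  have hlt : (Spart b (n - T.card) : ℝ) < Spart b (n - T.card + 1) := by
    have hpos : 0 < T.card := Finset.card_pos.2 ⟨i, by simp [T]⟩
    exact_mod_cast Spart_lt hb (Nat.lt_succ_self _) (by omega)
  linarith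

lemma monotone_comp_swap {n : ℕ} {a : Fin n → ℝ} {σ : Equiv.Perm (Fin n)}
    (hσ : Monotone (a ∘ σ)) {i j : Fin n} (hij : a i = a j) :
    Monotone (a ∘ (σ.trans (Equiv.swap i j))) := by
  have : a ∘ (σ.trans (Equiv.swap i j)) = a ∘ σ := by
    ext k
    simp only [Function.comp_apply, Equiv.trans_apply, Equiv.swap_apply_def]
    split_ifs with h1 h2
    · rw [h1, hij]
    · rw [h2, hij]
    · rfl
  rwa [this]

lemma greedy_swap {n : ℕ} (b : ℕ → ℕ) {a : Fin n → ℝ} (σ : Equiv.Perm (Fin n)) {i j : Fin n}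
    (hij : a i = a j) (k : Fin n) :
    greedy b a (σ.trans (Equiv.swap i j)) k = greedy b a σ (Equiv.swap i j k) := by
  have : a (Equiv.swap i j k) = a k := by
    rw [Equiv.swap_apply_def]
    split_ifs with h1 h2
    · rw [h1, hij]
    · rw [h2, hij]
    · rfl
  simp [greedy, this]

/-- Coordinates of equal level can be ordered either way on the face. -/
lemma exists_mem_maxFace_le {n : ℕ} {b : ℕ → ℕ} (hb : ∀ j < n, 1 ≤ b j) (hb1 : 2 ≤ b 0)
    {a : Fin n → ℝ} {i j : Fin n} (hj : 0 < a j) (hij : a i ≤ a j) :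
    ∃ x ∈ maxFace n b a, x i ≤ x j := by
  have hσ := Tuple.monotone_sort a
  rcases hij.lt_or_eq with h | h
  · obtain ⟨x, hx⟩ := maxFace_nonempty hb1 a
    exact ⟨x, hx, (lt_of_mem_maxFace hb hb1 hx hj h).le⟩
  · rcases le_total (greedy b a (Tuple.sort a) i) (greedy b a (Tuple.sort a) j) with hle | hle
    · exact ⟨_, greedy_mem_maxFace hb1 hσ, by exact_mod_cast hle⟩
    · refine ⟨_, greedy_mem_maxFace hb1 (monotone_comp_swap hσ h), ?_⟩
      simp only [greedy_swap b _ h, Equiv.swap_apply_left, Equiv.swap_apply_right]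
      exact_mod_cast hle

lemma update_greedy_mem_maxFace {n : ℕ} {b : ℕ → ℕ} (hb1 : 2 ≤ b 0) {a : Fin n → ℝ}
    {σ : Equiv.Perm (Fin n)} (hσ : Monotone (a ∘ σ)) {i : Fin n} (hi : a i = 0) :
    (fun j => ((Function.update (greedy b a σ) i 2 j : ℕ) : ℝ)) ∈ maxFace n b a := by
  refine mem_maxFace_of_sorted hb1 hσ (fun j => ?_) (fun j => ?_) (fun j hj => ?_) (fun j hj => ?_)
  · rw [Function.update_apply]
    split_ifs
    · norm_num
    · exact one_le_greedy hb1 a σ j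
  · rw [Function.update_apply]
    split_ifs
    · exact two_le_Spart hb1 (Nat.succ_pos _)
    · exact greedy_le hb1 a σ j
  · rw [Function.update_of_ne (by rintro rfl; exact hj.ne' hi)]
    simp [greedy, hj]
  · rw [Function.update_of_ne (by rintro rfl; exact hj.ne hi)]
    simp [greedy, hj.le]

/-- The sign of each coefficient can be read off the face. -/
lemma sign_of_maxFace_eq {n : ℕ} {b : ℕ → ℕ} (hb1 : 2 ≤ b 0) {a a' : Fin n → ℝ}
    (h : maxFace n b a = maxFace n b a') (i : Fin n) :
    (a i < 0 → a' i < 0) ∧ (0 < a i → 0 < a' i) := by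
  have hσ := Tuple.monotone_sort a'
  constructor
  · intro hi
    have hone : ∀ x ∈ maxFace n b a', x i = 1 := fun x hx =>
      ((mem_maxFace_iff hb1 a x).1 (h ▸ hx)).2.1 i hi
    by_contra! hi'
    rcases hi'.eq_or_lt with h0 | hpos
    · simpa using hone _ (update_greedy_mem_maxFace hb1 hσ h0.symm)
    · obtain ⟨x, hx⟩ := maxFace_nonempty hb1 a'
      linarith [two_le_of_mem_maxFace hb1 hx hpos, hone x hx]
  · intro hi
    by_contra! hi'
    have hmem := greedy_mem_maxFace (b := b) hb1 hσ
    have h2 := two_le_of_mem_maxFace hb1 (h ▸ hmem) hi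
    norm_num [greedy, hi'.not_gt] at h2

/-- The order of the positive coefficients can be read off the face. -/
lemma lt_of_maxFace_eq {n : ℕ} {b : ℕ → ℕ} (hb : ∀ j < n, 1 ≤ b j) (hb1 : 2 ≤ b 0)
    {a a' : Fin n → ℝ} (h : maxFace n b a = maxFace n b a') {i j : Fin n} (hi : 0 < a i)
    (hj : 0 < a j) (hij : a i < a j) : a' i < a' j := by
  by_contra! hle
  obtain ⟨x, hx, hxle⟩ := exists_mem_maxFace_le hb hb1 ((sign_of_maxFace_eq hb1 h i).2 hi) hle
  exact absurd (lt_of_mem_maxFace hb hb1 (h ▸ hx) hj hij) hxle.not_gt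

lemma maxFace_congr {n : ℕ} {b : ℕ → ℕ} (hb1 : 2 ≤ b 0) {a a' : Fin n → ℝ}
    (hneg : ∀ i, a i < 0 ↔ a' i < 0) (hpos : ∀ i, 0 < a i ↔ 0 < a' i)
    (hle : ∀ i j, 0 < a i → 0 < a j → (a i ≤ a j ↔ a' i ≤ a' j)) :
    maxFace n b a = maxFace n b a' := by
  ext x
  rw [mem_maxFace_iff hb1, mem_maxFace_iff hb1]
  have hlevel : ∀ i, 0 < a i →
      Finset.univ.filter (a i ≤ a ·) = Finset.univ.filter (a' i ≤ a' ·) := by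
    intro i hi
    ext j
    simp only [Finset.mem_filter, Finset.mem_univ, true_and]
    constructor
    · intro h
      exact (hle i j hi (hi.trans_le h)).1 h
    · intro h
      exact (hle i j hi ((hpos j).2 (((hpos i).1 hi).trans_le h))).2 h
  refine and_congr_right fun _ => and_congr (forall_congr' fun i => by rw [hneg i])
    (forall_congr' fun i => ?_)
  rw [← hpos i]
  exact forall_congr' fun hi => by rw [hlevel i hi]

/-- The block of a coordinate: negative coordinates form singletons, the other ones are grouped by
their coefficient. -/
noncomputable def blockOf {n : ℕ} (a : Fin n → ℝ) (i : Fin n) : Fin n ⊕ ℝ :=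
  if a i < 0 then Sum.inl i else Sum.inr (a i)

/-- The blocks on which the coordinate sum is constant on the face of `a`. -/
noncomputable def fixedBlocks {n : ℕ} (a : Fin n → ℝ) : Finset (Fin n ⊕ ℝ) :=
  (Finset.univ.image (blockOf a)).erase (Sum.inr 0)

/-- The block sums over the fixed blocks. -/
noncomputable def blockSums {n : ℕ} (a : Fin n → ℝ) :
    (Fin n → ℝ) →ₗ[ℝ] (fixedBlocks a → ℝ) where
  toFun v κ := ∑ i with blockOf a i = κ, v i
  map_add' v w := by ext; simp [Finset.sum_add_distrib]
  map_smul' c v := by ext; simp [Finset.mul_sum]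

lemma blockSums_surjective {n : ℕ} (a : Fin n → ℝ) : Function.Surjective (blockSums a) := by
  have hrep : ∀ κ : fixedBlocks a, ∃ i, blockOf a i = κ := by
    rintro ⟨κ, hκ⟩
    simpa using Finset.mem_of_mem_erase hκ
  choose r hr using hrep
  intro w
  refine ⟨∑ κ, w κ • Pi.single (r κ) 1, ?_⟩
  have hsingle : ∀ κ, blockSums a (Pi.single (r κ) 1) = Pi.single κ 1 := by
    intro κ
    ext κ'
    simp only [blockSums, LinearMap.coe_mk, AddHom.coe_mk, Finset.sum_filter, Pi.single_apply]
    rw [Finset.sum_eq_single (r κ)]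
    · rw [hr, if_pos rfl]
      exact if_congr (Subtype.ext_iff.symm.trans eq_comm) rfl rfl
    · intro i _ hi
      simp [hi]
    · simp
  rw [map_sum]
  simp only [map_smul, hsingle]
  ext κ
  simp [Finset.sum_apply, Pi.single_apply]

lemma finrank_ker_blockSums {n : ℕ} (a : Fin n → ℝ) :
    (fixedBlocks a).card + Module.finrank ℝ (LinearMap.ker (blockSums a)) = n := by
  have h := LinearMap.finrank_range_add_finrank_ker (blockSums a)
  rw [LinearMap.range_eq_top.2 (blockSums_surjective a), finrank_top] at h
  simpa using h

lemma card_fixedBlocks {n : ℕ} (a : Fin n → ℝ) :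
    (fixedBlocks a).card
      = (Finset.univ.filter (a · < 0)).card + ((Finset.univ.image a).filter (0 < ·)).card := by
  have : fixedBlocks a
      = (Finset.univ.filter (a · < 0)).disjSum ((Finset.univ.image a).filter (0 < ·)) := by
    ext κ
    rcases κ with i | t
    · simp only [fixedBlocks, blockOf, Finset.mem_erase, Finset.mem_image, Finset.mem_univ,
        true_and, Finset.inl_mem_disjSum, Finset.mem_filter, ne_eq, reduceCtorEq, not_false_eq_true]
      constructor
      · rintro ⟨j, hj⟩
        split_ifs at hj with h
        rwa [← Sum.inl.inj hj]
      · intro h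
        exact ⟨i, by rw [if_pos h]⟩
    · simp only [fixedBlocks, blockOf, Finset.mem_erase, Finset.mem_image, Finset.mem_univ,
        true_and, Finset.inr_mem_disjSum, Finset.mem_filter, ne_eq, Sum.inr.injEq]
      constructor
      · rintro ⟨h0, j, hj⟩
        split_ifs at hj with h
        obtain rfl := Sum.inr.inj hj
        exact ⟨⟨j, rfl⟩, lt_of_le_of_ne (not_lt.1 h) (Ne.symm h0)⟩
      · rintro ⟨⟨j, rfl⟩, h⟩
        exact ⟨h.ne', j, by rw [if_neg h.not_gt]⟩
  rw [this, Finset.card_disjSum]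

lemma sum_gt_eq {n : ℕ} {b : ℕ → ℕ} {a x y : Fin n → ℝ} (hx : IsTight n b a x)
    (hy : IsTight n b a y) {t : ℝ} (ht : 0 < t) :
    ∑ j with t < a j, x j = ∑ j with t < a j, y j := by
  rcases (Finset.univ.filter (t < a ·)).eq_empty_or_nonempty with he | hne
  · rw [he]; simp
  · obtain ⟨i, hi, hmin⟩ := Finset.exists_min_image _ a hne
    simp only [Finset.mem_filter, Finset.mem_univ, true_and] at hi hmin
    have : Finset.univ.filter (t < a ·) = Finset.univ.filter (a i ≤ a ·) := by
      ext j
      simp only [Finset.mem_filter, Finset.mem_univ, true_and]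
      exact ⟨hmin j, hi.trans_le⟩
    rw [this, hx.2 i (ht.trans hi), hy.2 i (ht.trans hi)]

lemma sum_block_eq {n : ℕ} {b : ℕ → ℕ} {a x y : Fin n → ℝ} (hx : IsTight n b a x)
    (hy : IsTight n b a y) {i : Fin n} (hi : 0 < a i) :
    ∑ j with a j = a i, x j = ∑ j with a j = a i, y j := by
  have hsplit : ∀ z : Fin n → ℝ, ∑ j with a i ≤ a j, z j
      = ∑ j with a j = a i, z j + ∑ j with a i < a j, z j := by
    intro z
    rw [← Finset.sum_union]
    · refine Finset.sum_congr ?_ fun _ _ => rfl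
      ext j
      simp only [Finset.mem_union, Finset.mem_filter, Finset.mem_univ, true_and]
      rw [le_iff_eq_or_lt, eq_comm]
    · rw [Finset.disjoint_filter]
      intro j _ h1 h2
      exact h2.ne' h1
  linarith [hsplit x, hsplit y, hx.2 i hi, hy.2 i hi, sum_gt_eq hx hy hi]

lemma vectorSpan_maxFace {n : ℕ} {b : ℕ → ℕ} (hb : ∀ j < n, 1 ≤ b j) (hb1 : 2 ≤ b 0)
    (a : Fin n → ℝ) : vectorSpan ℝ (maxFace n b a) = LinearMap.ker (blockSums a) := by
  apply le_antisymm
  · rw [vectorSpan, Submodule.span_le]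
    rintro _ ⟨x, hx, y, hy, rfl⟩
    have hx := ((mem_maxFace_iff hb1 a x).1 hx).2
    have hy := ((mem_maxFace_iff hb1 a y).1 hy).2
    rw [SetLike.mem_coe, LinearMap.mem_ker]
    ext ⟨κ, hκ⟩
    simp only [fixedBlocks, Finset.mem_erase, Finset.mem_image, Finset.mem_univ, true_and] at hκ
    obtain ⟨h0, i, rfl⟩ := hκ
    simp only [blockSums, LinearMap.coe_mk, AddHom.coe_mk, vsub_eq_sub, Pi.sub_apply,
      Finset.sum_sub_distrib, Pi.zero_apply]
    by_cases hi : a i < 0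
    · rw [← Finset.sum_sub_distrib]
      refine Finset.sum_eq_zero fun j hj => ?_
      simp only [Finset.mem_filter, Finset.mem_univ, true_and, blockOf, if_pos hi] at hj
      split_ifs at hj with h
      rw [hx.1 j h, hy.1 j h, sub_self]
    · have hpos : 0 < a i := by
        refine lt_of_le_of_ne (not_lt.1 hi) fun h => h0 ?_
        rw [blockOf, if_neg hi, ← h]
      have hblock : (Finset.univ.filter fun j => blockOf a j = blockOf a i)
          = Finset.univ.filter fun j => a j = a i := by
        ext j
        simp only [Finset.mem_filter, Finset.mem_univ, true_and, blockOf, if_neg hi]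
        split_ifs with h
        · simpa using (h.trans hpos).ne
        · simp
      rw [hblock, sum_block_eq hx hy hpos, sub_self]
  · have hσ := Tuple.monotone_sort a
    set σ := Tuple.sort a
    have hzero : ∀ i, a i = 0 → (Pi.single i 1 : Fin n → ℝ) ∈ vectorSpan ℝ (maxFace n b a) := by
      intro i hi
      have h := vsub_mem_vectorSpan ℝ (update_greedy_mem_maxFace hb1 hσ hi)
        (greedy_mem_maxFace (b := b) hb1 hσ)
      convert h using 1
      ext j
      by_cases hj : j = i
      · subst hj
        norm_num [greedy, hi]
      · simp [hj]
    have hdiff : ∀ i j, blockOf a i = blockOf a j → a i ≠ 0 →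
        (Pi.single i 1 - Pi.single j 1 : Fin n → ℝ) ∈ vectorSpan ℝ (maxFace n b a) := by
      intro i j hij hi0
      by_cases hne : i = j
      · subst hne; simp
      have hpos : 0 < a i ∧ a i = a j := by
        unfold blockOf at hij
        split_ifs at hij with h1 h2 h2
        · exact absurd (Sum.inl.inj hij) hne
        · exact ⟨lt_of_le_of_ne (not_lt.1 h1) (Ne.symm hi0), Sum.inr.inj hij⟩
      obtain ⟨hi, haij⟩ := hpos
      have h := vsub_mem_vectorSpan ℝ (greedy_mem_maxFace (b := b) hb1 hσ)
        (greedy_mem_maxFace (b := b) hb1 (monotone_comp_swap hσ haij))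
      have hne' : (greedy b a σ i : ℝ) - greedy b a σ j ≠ 0 := by
        rw [sub_ne_zero, Ne, Nat.cast_inj]
        simp only [greedy, if_pos hi, if_pos (haij ▸ hi : 0 < a j)]
        have : (σ.symm i : ℕ) ≠ σ.symm j := by
          simpa [Fin.val_inj] using hne
        rcases this.lt_or_gt with hlt | hlt
        · exact (Spart_lt hb (Nat.succ_lt_succ hlt) (σ.symm j).2).ne
        · exact (Spart_lt hb (Nat.succ_lt_succ hlt) (σ.symm i).2).ne'
      rw [← Submodule.smul_mem_iff _ hne']
      convert h using 1
      ext k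
      simp only [greedy_swap b σ haij, Pi.smul_apply, Pi.sub_apply, Pi.single_apply, smul_eq_mul,
        vsub_eq_sub, Equiv.swap_apply_def]
      by_cases hki : k = i
      · subst hki; simp [hne]
      · by_cases hkj : k = j
        · subst hkj; simp [hki]
        · simp [hki, hkj]
    intro v hv
    rw [LinearMap.mem_ker] at hv
    rw [← Submodule.Quotient.mk_eq_zero]
    change Submodule.mkQ _ v = 0
    have hv' : v = ∑ i, v i • (Pi.single i 1 : Fin n → ℝ) := by
      ext k
      simp [Finset.sum_apply, Pi.single_apply]
    rw [hv', map_sum, ← Finset.sum_fiberwise_of_maps_to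
      (fun i _ => Finset.mem_image_of_mem (blockOf a) (Finset.mem_univ i))]
    refine Finset.sum_eq_zero fun κ hκ => ?_
    obtain ⟨i, -, rfl⟩ := Finset.mem_image.1 hκ
    by_cases hi : a i = 0
    · refine Finset.sum_eq_zero fun j hj => ?_
      have hj0 : a j = 0 := by
        have h := (Finset.mem_filter.1 hj).2
        simp only [blockOf, hi, lt_irrefl, if_false] at h
        split_ifs at h
        exact Sum.inr.inj h
      rw [map_smul, Submodule.mkQ_apply, (Submodule.Quotient.mk_eq_zero _).2 (hzero j hj0),
        smul_zero]
    · have hκ' : blockOf a i ∈ fixedBlocks a := by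
        refine Finset.mem_erase.2 ⟨fun h => hi ?_, hκ⟩
        unfold blockOf at h
        split_ifs at h
        exact Sum.inr.inj h
      have hsum : ∑ j with blockOf a j = blockOf a i, v j = 0 := congrFun hv ⟨_, hκ'⟩
      have hrep : ∀ j ∈ Finset.univ.filter (fun j => blockOf a j = blockOf a i),
          (vectorSpan ℝ (maxFace n b a)).mkQ (v j • Pi.single j 1)
            = v j • (vectorSpan ℝ (maxFace n b a)).mkQ (Pi.single i 1) := by
        intro j hj
        rw [map_smul]
        congr 1
        exact ((Submodule.Quotient.eq _).2 (hdiff i j (Finset.mem_filter.1 hj).2.symm hi)).symm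
      rw [Finset.sum_congr rfl hrep, ← Finset.sum_smul, hsum, zero_smul]

lemma finrank_vectorSpan_maxFace {n : ℕ} {b : ℕ → ℕ} (hb : ∀ j < n, 1 ≤ b j) (hb1 : 2 ≤ b 0)
    (a : Fin n → ℝ) :
    (Finset.univ.filter (a · < 0)).card + ((Finset.univ.image a).filter (0 < ·)).card
      + Module.finrank ℝ (vectorSpan ℝ (maxFace n b a)) = n := by
  rw [vectorSpan_maxFace hb hb1, ← card_fixedBlocks, finrank_ker_blockSums]

lemma isExposed_and_nonempty_iff {n : ℕ} {b : ℕ → ℕ} (hb1 : 2 ≤ b 0) (F : Set (Fin n → ℝ)) :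
    (F.Nonempty ∧ IsExposed ℝ (bpfPolytope n b) F) ↔ ∃ a, F = maxFace n b a := by
  constructor
  · rintro ⟨hne, hF⟩
    obtain ⟨l, rfl⟩ := hF hne
    refine ⟨fun i => l (Pi.single i 1), ?_⟩
    have hl : ∀ x : Fin n → ℝ, l x = ∑ i, l (Pi.single i 1) * x i := by
      intro x
      have hx : x = ∑ i, x i • (Pi.single i 1 : Fin n → ℝ) := by
        ext k
        simp [Finset.sum_apply, Pi.single_apply]
      conv_lhs => rw [hx, map_sum]
      exact Finset.sum_congr rfl fun i _ => by rw [map_smul, smul_eq_mul, mul_comm]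
    ext x
    simp only [maxFace, Set.mem_ofPred_eq, hl x]
    refine and_congr_right fun _ => forall₂_congr fun y _ => by rw [hl y]
  · rintro ⟨a, rfl⟩
    refine ⟨maxFace_nonempty hb1 a, fun _ =>
      ⟨∑ i, a i • ContinuousLinearMap.proj (R := ℝ) i, ?_⟩⟩
    simp [maxFace]

/-- The values `1, …, m + 1` of a code with `m` positive levels. -/
def codeLevels (n m : ℕ) : Finset (Fin (n + 2)) :=
  {v | 1 ≤ (v : ℕ) ∧ (v : ℕ) ≤ m + 1}

lemma card_codeLevels {n m : ℕ} (hm : m ≤ n) : (codeLevels n m).card = m + 1 := by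
  have : (codeLevels n m).map Fin.valEmbedding = Finset.Icc 1 (m + 1) := by
    ext v
    simp only [codeLevels, Finset.mem_map, Finset.mem_filter, Finset.mem_univ, true_and,
      Fin.valEmbedding_apply, Finset.mem_Icc]
    constructor
    · rintro ⟨w, hw, rfl⟩
      exact hw
    · intro hv
      exact ⟨⟨v, by omega⟩, hv, rfl⟩
  rw [← Finset.card_map Fin.valEmbedding, this, Nat.card_Icc, Nat.add_sub_cancel]

/-- The functional of a code: `0` codes a negative coefficient, `1` a zero coefficient, and larger
values the levels of the positive coefficients. -/
def codeCoeff {n : ℕ} (c : Fin n → Fin (n + 2)) (i : Fin n) : ℝ := ((c i : ℕ) : ℝ) - 1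

lemma codeCoeff_neg_iff {n : ℕ} (c : Fin n → Fin (n + 2)) (i : Fin n) :
    codeCoeff c i < 0 ↔ (c i : ℕ) = 0 := by
  rw [codeCoeff, sub_neg, Nat.cast_lt_one]

lemma codeCoeff_pos_iff {n : ℕ} (c : Fin n → Fin (n + 2)) (i : Fin n) :
    0 < codeCoeff c i ↔ 2 ≤ (c i : ℕ) := by
  rw [codeCoeff, sub_pos, Nat.one_lt_cast, Nat.succ_le_iff]

lemma mem_patternFinset_codeLevels {n j m : ℕ} (hm : m ≤ n) (c : Fin n → Fin (n + 2)) :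
    c ∈ patternFinset 0 1 n j (codeLevels n m) ↔
      (Finset.univ.filter fun i => (c i : ℕ) = 0).card = j ∧ (∀ i, (c i : ℕ) ≤ m + 1) ∧
        ∀ v, 2 ≤ v → v ≤ m + 1 → ∃ i, (c i : ℕ) = v := by
  simp only [patternFinset, Finset.mem_filter, Finset.mem_univ, true_and]
  refine and_congr (by simp only [Fin.ext_iff, Fin.val_zero]) ?_
  rw [Finset.ext_iff]
  simp only [codeLevels, Finset.mem_insert, Finset.mem_erase, Finset.mem_image, Finset.mem_univ,
    true_and, Finset.mem_filter, Fin.ext_iff, Fin.val_zero, Fin.val_one, ne_eq]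
  constructor
  · intro h
    constructor
    · intro i
      by_cases hi : (c i : ℕ) = 0
      · omega
      · exact ((h (c i)).1 (Or.inr ⟨hi, i, rfl⟩)).2
    · intro v hv hv'
      rcases (h ⟨v, by omega⟩).2 ⟨by simp; omega, by simpa using hv'⟩ with h1 | ⟨-, i, hi⟩
      · simp at h1; omega
      · exact ⟨i, hi⟩
  · rintro ⟨h1, h2⟩ v
    constructor
    · rintro (hv | ⟨hv, i, hi⟩)
      · omega
      · have := h1 i
        omega
    · rintro ⟨hv, hv'⟩
      by_cases hv1 : (v : ℕ) = 1
      · exact Or.inl hv1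
      · obtain ⟨i, hi⟩ := h2 v (by omega) hv'
        exact Or.inr ⟨by omega, i, hi⟩

lemma finrank_maxFace_code {n : ℕ} {b : ℕ → ℕ} (hb : ∀ j < n, 1 ≤ b j) (hb1 : 2 ≤ b 0)
    {j m : ℕ} (hm : m ≤ n) {c : Fin n → Fin (n + 2)}
    (hc : c ∈ patternFinset 0 1 n j (codeLevels n m)) :
    j + m + Module.finrank ℝ (vectorSpan ℝ (maxFace n b (codeCoeff c))) = n := by
  obtain ⟨hj, hle, hsurj⟩ := (mem_patternFinset_codeLevels hm c).1 hc
  have h := finrank_vectorSpan_maxFace hb hb1 (codeCoeff c)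
  have hlevels : (Finset.univ.image (codeCoeff c)).filter (0 < ·)
      = (Finset.Icc 1 m).image (fun v : ℕ => (v : ℝ)) := by
    ext t
    simp only [Finset.mem_filter, Finset.mem_image, Finset.mem_univ, true_and, Finset.mem_Icc]
    constructor
    · rintro ⟨⟨i, rfl⟩, hi⟩
      rw [codeCoeff_pos_iff] at hi
      have := hle i
      refine ⟨(c i : ℕ) - 1, by omega, ?_⟩
      rw [codeCoeff, Nat.cast_sub (by omega), Nat.cast_one]
    · rintro ⟨v, hv, rfl⟩
      obtain ⟨i, hi⟩ := hsurj (v + 1) (by omega) (by omega)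
      refine ⟨⟨i, by simp [codeCoeff, hi]⟩, ?_⟩
      exact_mod_cast hv.1
  rw [hlevels, Finset.card_image_of_injective _ Nat.cast_injective, Nat.card_Icc,
    Nat.add_sub_cancel] at h
  simp only [codeCoeff_neg_iff, hj] at h
  exact h

lemma code_le_of_maxFace_eq {n : ℕ} {b : ℕ → ℕ} (hb : ∀ j < n, 1 ≤ b j) (hb1 : 2 ≤ b 0)
    {j m : ℕ} (hm : m ≤ n) {c c' : Fin n → Fin (n + 2)}
    (hc : c ∈ patternFinset 0 1 n j (codeLevels n m))
    (h : maxFace n b (codeCoeff c) = maxFace n b (codeCoeff c')) (i : Fin n) : c i ≤ c' i := by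
  obtain ⟨-, hle, hsurj⟩ := (mem_patternFinset_codeLevels hm c).1 hc
  rw [Fin.le_def]
  induction hv : (c i : ℕ) using Nat.strong_induction_on generalizing i with
  | _ v ih =>
    have hneg := (sign_of_maxFace_eq hb1 h.symm i).1
    have hpos := (sign_of_maxFace_eq hb1 h i).2
    rw [codeCoeff_neg_iff, codeCoeff_neg_iff] at hneg
    rw [codeCoeff_pos_iff, codeCoeff_pos_iff] at hpos
    by_cases h3 : v ≤ 2
    · omega
    · obtain ⟨k, hk⟩ := hsurj (v - 1) (by omega) (by have := hle i; omega)
      have h1 := ih (v - 1) (by omega) k hk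
      have h2 : codeCoeff c' k < codeCoeff c' i := by
        refine lt_of_maxFace_eq hb hb1 h ?_ ?_ ?_
        · rw [codeCoeff_pos_iff]; omega
        · rw [codeCoeff_pos_iff]; omega
        · rw [codeCoeff, codeCoeff, sub_lt_sub_iff_right, Nat.cast_lt]; omega
      rw [codeCoeff, codeCoeff, sub_lt_sub_iff_right, Nat.cast_lt] at h2
      omega

lemma exists_code {n : ℕ} {b : ℕ → ℕ} (hb1 : 2 ≤ b 0) (a : Fin n → ℝ) :
    ∃ m ≤ n, ∃ j, ∃ c ∈ patternFinset 0 1 n j (codeLevels n m),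
      maxFace n b a = maxFace n b (codeCoeff c) := by
  set V := (Finset.univ.image a).filter (0 < ·) with hV
  have hm : V.card ≤ n :=
    (Finset.card_filter_le _ _).trans (Finset.card_image_le.trans (by simp))
  have hmem : ∀ i, 0 < a i → a i ∈ V := fun i hi => by simp [hV, hi]
  set e := V.orderIsoOfFin rfl
  set c : Fin n → Fin (n + 2) := fun i =>
    if h : 0 < a i then ⟨(e.symm ⟨a i, hmem i h⟩ : ℕ) + 2, by
      have := (e.symm ⟨a i, hmem i h⟩).2
      omega⟩
    else if a i < 0 then 0 else 1 with hcdef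
  have hcpos : ∀ i (h : 0 < a i), (c i : ℕ) = (e.symm ⟨a i, hmem i h⟩ : ℕ) + 2 := fun i h => by
    simp [hcdef, h]
  have hcneg : ∀ i, a i < 0 → (c i : ℕ) = 0 := fun i h => by simp [hcdef, h, h.le]
  have hczero : ∀ i, a i = 0 → (c i : ℕ) = 1 := fun i h => by simp [hcdef, h]
  refine ⟨V.card, hm, _, c, (mem_patternFinset_codeLevels hm c).2 ⟨rfl, fun i => ?_, fun v hv hv' =>
    ?_⟩, maxFace_congr hb1 (fun i => ?_) (fun i => ?_) (fun i j hi hj => ?_)⟩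
  · rcases lt_trichotomy (a i) 0 with h | h | h
    · rw [hcneg i h]; omega
    · rw [hczero i h]; omega
    · rw [hcpos i h]
      have := (e.symm ⟨a i, hmem i h⟩).2
      omega
  · have hx := (e ⟨v - 2, by omega⟩).2
    replace hx := Finset.mem_filter.1 hx
    rw [Finset.mem_image] at hx
    obtain ⟨⟨i, -, hi⟩, hpos⟩ := hx
    refine ⟨i, ?_⟩
    rw [hcpos i (hi ▸ hpos)]
    have : (⟨a i, hmem i (hi ▸ hpos)⟩ : V) = e ⟨v - 2, by omega⟩ := Subtype.ext hi
    rw [this, OrderIso.symm_apply_apply]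
    simp only
    omega
  · rw [codeCoeff_neg_iff]
    rcases lt_trichotomy (a i) 0 with h | h | h
    · simp [h, hcneg i h]
    · simp [h, hczero i h]
    · simp [h.le, hcpos i h]
  · rw [codeCoeff_pos_iff]
    rcases lt_trichotomy (a i) 0 with h | h | h
    · simp [h.le, hcneg i h]
    · simp [h, hczero i h]
    · simp [h, hcpos i h]
  · rw [codeCoeff, codeCoeff, sub_le_sub_iff_right, Nat.cast_le, hcpos i hi, hcpos j hj,
      Nat.add_le_add_iff_right, Fin.val_fin_le, OrderIso.le_iff_le, Subtype.mk_le_mk]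

/-- For `b_1 ≥ 2`, the number of `k`-faces of `X_n(b)` is
`∑_{j=0}^{n-k} C(n,j)·(n-k-j)!·S(n-j+1, n-k-j+1)`. -/
theorem face_count_b1_ge_two (n : ℕ) (b : ℕ → ℕ) (hb : ∀ j < n, 1 ≤ b j)
    (hb1 : 2 ≤ b 0) (k : ℕ) (hk : k ≤ n) :
    faceCount n b k
      = ∑ j ∈ Finset.range (n - k + 1),
          n.choose j * (n - k - j)! * stirling2 (n - j + 1) (n - k - j + 1) := by
  classical
  set C : ℕ → Finset (Fin n → Fin (n + 2)) := fun j =>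
    patternFinset 0 1 n j (codeLevels n (n - k - j))
  have hfaces : {F : Set (Fin n → ℝ) | F.Nonempty ∧ IsExposed ℝ (bpfPolytope n b) F ∧
      Module.finrank ℝ (vectorSpan ℝ F) = k}
        = (fun c => maxFace n b (codeCoeff c)) '' ↑((Finset.range (n - k + 1)).biUnion C) := by
    ext F
    rw [Set.mem_ofPred_eq, ← and_assoc, isExposed_and_nonempty_iff hb1]
    simp only [Set.mem_image, Finset.mem_coe, Finset.mem_biUnion, Finset.mem_range]
    constructor
    · rintro ⟨⟨a, rfl⟩, hF⟩
      obtain ⟨m, hm, j, c, hc, h⟩ := exists_code hb1 a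
      have hdim := finrank_maxFace_code hb hb1 hm hc
      rw [← h, hF] at hdim
      refine ⟨c, ⟨j, by omega, ?_⟩, h.symm⟩
      simp only [C]
      rwa [show n - k - j = m by omega]
    · rintro ⟨c, ⟨j, hj, hc⟩, rfl⟩
      have hdim := finrank_maxFace_code hb hb1 (by omega) hc
      exact ⟨⟨_, rfl⟩, by omega⟩
  have hinj : Set.InjOn (fun c => maxFace n b (codeCoeff c))
      ↑((Finset.range (n - k + 1)).biUnion C) := by
    intro c hc c' hc' h
    obtain ⟨j, -, hc⟩ := Finset.mem_biUnion.1 (Finset.mem_coe.1 hc)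
    obtain ⟨j', -, hc'⟩ := Finset.mem_biUnion.1 (Finset.mem_coe.1 hc')
    ext1 i
    exact le_antisymm (code_le_of_maxFace_eq hb hb1 (by omega) hc h i)
      (code_le_of_maxFace_eq hb hb1 (by omega) hc' h.symm i)
  rw [faceCount, hfaces, hinj.ncard_image, Set.ncard_coe_finset, Finset.card_biUnion]
  · refine Finset.sum_congr rfl fun j _ => ?_
    refine card_patternFinset n j (n - k - j) _ ?_ ?_ (card_codeLevels (by omega))
    · simp [codeLevels]
    · simp [codeLevels]
  · intro j _ j' _ hjj'
    rw [Function.onFun, Finset.disjoint_left]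
    intro c hc hc'
    simp only [C, patternFinset, Finset.mem_filter] at hc hc'
    exact hjj' (hc.2.1.symm.trans hc'.2.1)
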